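/- Let B be a Fell bundle over a groupoid H and M a right B-demi-equivalence. For x,y,z ∈ X with σ(x)=σ(y)=σ(z)=u, the multiplication map U : (M(x) ⊗_u M(y)^op) × (M(y) ⊗_u M(z)^op) → M(x) ⊗_u M(z)^op determined by U(m ⊗ n₁^op, n₂ ⊗ k^op) = (m ⊳ ⟨n₁,n₂⟩_B) ⊗ k^op is well defined and bilinear, satisfies ‖U(ξ,η)‖ ≤ ‖ξ‖·‖η‖, and satisfies ‖U(ξ, Flip(ξ))‖ = ‖ξ‖², where Flip(m ⊗ n^op) = n ⊗ m^op. -/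

import Mathlib

/- Statement 13: the multiplication map
U : (M(x) ⊗_u M(y)^op) × (M(y) ⊗_u M(z)^op) → M(x) ⊗_u M(z)^op determined by
U(m ⊗ n₁^op, n₂ ⊗ k^op) = (m ⊳ ⟨n₁,n₂⟩_B) ⊗ k^op is well defined, bilinear,
submultiplicative in norm, and satisfies ‖U(ξ, Flip ξ)‖ = ‖ξ‖². -/

/-- An upper semicontinuous Banach bundle over a topological space. -/
structure IsUSCBanachBundle {X : Type*} [TopologicalSpace X] (E : X → Type*)
    [∀ x, NormedAddCommGroup (E x)] [∀ x, NormedSpace ℂ (E x)] [∀ x, CompleteSpace (E x)]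
    [TopologicalSpace (Σ x, E x)] : Prop where
  cont_proj : Continuous (Sigma.fst : (Σ x, E x) → X)
  open_proj : IsOpenMap (Sigma.fst : (Σ x, E x) → X)
  usc_norm : UpperSemicontinuous (fun m : Σ x, E x => ‖m.2‖)
  cont_add : Continuous (fun p : {q : (Σ x, E x) × (Σ x, E x) // q.1.1 = q.2.1} =>
    (⟨p.1.1.1, p.1.1.2 + cast (congrArg E p.2).symm p.1.2.2⟩ : Σ x, E x))
  cont_smul : Continuous (fun p : ℂ × (Σ x, E x) => (⟨p.2.1, p.1 • p.2.2⟩ : Σ x, E x))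
  zero_criterion : ∀ (F : Filter (Σ x, E x)) (x : X),
    Filter.Tendsto (fun m : Σ x, E x => ‖m.2‖) F (nhds 0) →
      Filter.Tendsto Sigma.fst F (nhds x) → F ≤ nhds (⟨x, 0⟩ : Σ x, E x)

/-- A topological groupoid: a topological space `G` with source and range maps (valued in the
units, viewed inside `G`), a partially defined multiplication, and inversion, all continuous. -/
structure TopGroupoid (G : Type*) [TopologicalSpace G] : Type _ where
  src : G → G
  rng : G → G
  mul : (g h : G) → src g = rng h → G
  inv : G → G
  rng_src : ∀ g, rng (src g) = src g
  src_src : ∀ g, src (src g) = src g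
  src_rng : ∀ g, src (rng g) = rng g
  rng_rng : ∀ g, rng (rng g) = rng g
  src_mul : ∀ g h hgh, src (mul g h hgh) = src h
  rng_mul : ∀ g h hgh, rng (mul g h hgh) = rng g
  mul_assoc : ∀ g h k (hgh : src g = rng h) (hhk : src h = rng k)
    (h₁ : src (mul g h hgh) = rng k) (h₂ : src g = rng (mul h k hhk)),
    mul (mul g h hgh) k h₁ = mul g (mul h k hhk) h₂
  src_inv : ∀ g, src (inv g) = rng g
  rng_inv : ∀ g, rng (inv g) = src g
  mul_inv : ∀ g (h : src g = rng (inv g)), mul g (inv g) h = rng g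
  inv_mul : ∀ g (h : src (inv g) = rng g), mul (inv g) g h = src g
  mul_src : ∀ g (h : src g = rng (src g)), mul g (src g) h = g
  rng_mul' : ∀ g (h : src (rng g) = rng g), mul (rng g) g h = g
  continuous_src : Continuous src
  continuous_rng : Continuous rng
  continuous_inv : Continuous inv
  continuous_mul : Continuous (fun p : {p : G × G // src p.1 = rng p.2} =>
    mul p.1.1 p.1.2 p.2)

namespace TopGroupoid

variable {G : Type*} [TopologicalSpace G] (𝒢 : TopGroupoid G)

/-- The unit space of the groupoid, viewed as a subset of `G`. -/
def units : Set G := Set.range 𝒢.rng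

/-- The source map is open (onto the unit space, with its subspace topology). -/
def OpenSource : Prop :=
  ∀ U : Set G, IsOpen U → ∃ V : Set G, IsOpen V ∧ 𝒢.src '' U = V ∩ 𝒢.units

end TopGroupoid

/-- A continuous right action of a topological groupoid `H` on a topological space `X`,
along an anchor map `σ : X → H` (valued in the units of `H`). -/
structure RightGroupoidAction {H : Type*} [TopologicalSpace H] (𝒢 : TopGroupoid H)
    (X : Type*) [TopologicalSpace X] : Type _ where
  anchor : X → H
  anchor_unit : ∀ x, 𝒢.rng (anchor x) = anchor x
  continuous_anchor : Continuous anchor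
  act : (x : X) → (h : H) → anchor x = 𝒢.rng h → X
  anchor_act : ∀ x h hc, anchor (act x h hc) = 𝒢.src h
  act_unit : ∀ x (hc : anchor x = 𝒢.rng (anchor x)), act x (anchor x) hc = x
  act_mul : ∀ x h h' (hc : anchor x = 𝒢.rng h) (hc' : anchor (act x h hc) = 𝒢.rng h')
    (hhh : 𝒢.src h = 𝒢.rng h') (hc'' : anchor x = 𝒢.rng (𝒢.mul h h' hhh)),
    act (act x h hc) h' hc' = act x (𝒢.mul h h' hhh) hc''
  continuous_act : Continuous (fun p : {p : X × H // anchor p.1 = 𝒢.rng p.2} =>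
    act p.1.1 p.1.2 p.2)

namespace RightGroupoidAction

variable {H : Type*} [TopologicalSpace H] {𝒢 : TopGroupoid H}
  {X : Type*} [TopologicalSpace X] (ρ : RightGroupoidAction 𝒢 X)

/-- The action is free: only units act trivially. -/
def IsFree : Prop := ∀ x h hc, ρ.act x h hc = x → h = ρ.anchor x

/-- The action is proper: `(x, h) ↦ (x, x·h)` is a proper map. -/
def IsProper : Prop :=
  IsProperMap (fun p : {p : X × H // ρ.anchor p.1 = 𝒢.rng p.2} =>
    ((p.1.1, ρ.act p.1.1 p.1.2 p.2) : X × X))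

/-- The anchor map is open onto the unit space. -/
def OpenAnchor : Prop :=
  ∀ U : Set X, IsOpen U → ∃ V : Set H, IsOpen V ∧ ρ.anchor '' U = V ∩ 𝒢.units

/-- The anchor map is surjective onto the unit space. -/
def SurjAnchor : Prop := ∀ u ∈ 𝒢.units, ∃ x, ρ.anchor x = u

/-- `X` is a principal (free and proper) right `H`-space. -/
def IsPrincipal : Prop := ρ.IsFree ∧ ρ.IsProper

/-- Two points of the fibred product `X ×_{σ,σ} X` are equivalent when they differ by the
diagonal action of `H`. -/
def diagRel (p q : {p : X × X // ρ.anchor p.1 = ρ.anchor p.2}) : Prop :=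
  ∃ (h : H) (hc₁ : ρ.anchor p.1.1 = 𝒢.rng h) (hc₂ : ρ.anchor p.1.2 = 𝒢.rng h),
    q.1.1 = ρ.act p.1.1 h hc₁ ∧ q.1.2 = ρ.act p.1.2 h hc₂

end RightGroupoidAction

/-- A continuous left action of a topological groupoid. -/
structure LeftGroupoidAction {G : Type*} [TopologicalSpace G] (𝒢 : TopGroupoid G)
    (X : Type*) [TopologicalSpace X] : Type _ where
  anchor : X → G
  anchor_unit : ∀ x, 𝒢.rng (anchor x) = anchor x
  continuous_anchor : Continuous anchor
  act : (g : G) → (x : X) → 𝒢.src g = anchor x → X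
  anchor_act : ∀ g x hc, anchor (act g x hc) = 𝒢.rng g
  act_unit : ∀ x (hc : 𝒢.src (anchor x) = anchor x), act (anchor x) x hc = x
  act_mul : ∀ g g' x (hc : 𝒢.src g' = anchor x) (hc' : 𝒢.src g = anchor (act g' x hc))
    (hgg : 𝒢.src g = 𝒢.rng g') (hc'' : 𝒢.src (𝒢.mul g g' hgg) = anchor x),
    act g (act g' x hc) hc' = act (𝒢.mul g g' hgg) x hc''
  continuous_act : Continuous (fun p : {p : G × X // 𝒢.src p.1 = anchor p.2} =>
    act p.1.1 p.1.2 p.2)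

namespace LeftGroupoidAction

variable {G : Type*} [TopologicalSpace G] {𝒢 : TopGroupoid G}
  {X : Type*} [TopologicalSpace X] (lam : LeftGroupoidAction 𝒢 X)

def IsFree : Prop := ∀ g x hc, lam.act g x hc = x → g = lam.anchor x

def IsProper : Prop :=
  IsProperMap (fun p : {p : G × X // 𝒢.src p.1 = lam.anchor p.2} =>
    ((lam.act p.1.1 p.1.2 p.2, p.1.2) : X × X))

def OpenAnchor : Prop :=
  ∀ U : Set X, IsOpen U → ∃ V : Set G, IsOpen V ∧ lam.anchor '' U = V ∩ 𝒢.units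

def SurjAnchor : Prop := ∀ u ∈ 𝒢.units, ∃ x, lam.anchor x = u

def IsPrincipal : Prop := lam.IsFree ∧ lam.IsProper

end LeftGroupoidAction

/-- A `(G, H)`-groupoid equivalence: commuting principal left `G`- and right `H`-actions on
`X` whose anchor maps are open surjections onto the unit spaces and identify `X/H` with `G⁰`
and `G\X` with `H⁰` (encoded: the fibres of each anchor map are exactly the orbits of the
other action). -/
structure GroupoidEquivalence {G H : Type*} [TopologicalSpace G] [TopologicalSpace H]
    (𝒢 : TopGroupoid G) (ℋ : TopGroupoid H) (X : Type*) [TopologicalSpace X] : Type _ where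
  lact : LeftGroupoidAction 𝒢 X
  ract : RightGroupoidAction ℋ X
  commute : ∀ g x h (hcl : 𝒢.src g = lact.anchor x) (hcr : ract.anchor x = ℋ.rng h)
    (hcr' : ract.anchor (lact.act g x hcl) = ℋ.rng h)
    (hcl' : 𝒢.src g = lact.anchor (ract.act x h hcr)),
    ract.act (lact.act g x hcl) h hcr' = lact.act g (ract.act x h hcr) hcl'
  lact_principal : lact.IsPrincipal
  ract_principal : ract.IsPrincipal
  lact_openAnchor : lact.OpenAnchor
  ract_openAnchor : ract.OpenAnchor
  lact_surjAnchor : lact.SurjAnchor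
  ract_surjAnchor : ract.SurjAnchor
  /-- the right anchor `σ` is invariant under the left action and its fibres are the
  `G`-orbits -/
  ract_anchor_lact : ∀ g x hc, ract.anchor (lact.act g x hc) = ract.anchor x
  ract_anchor_eq_iff : ∀ x y, ract.anchor x = ract.anchor y ↔
    ∃ g hc, lact.act g y hc = x
  /-- the left anchor `ρ` is invariant under the right action and its fibres are the
  `H`-orbits -/
  lact_anchor_ract : ∀ x h hc, lact.anchor (ract.act x h hc) = lact.anchor x
  lact_anchor_eq_iff : ∀ x y, lact.anchor x = lact.anchor y ↔
    ∃ h hc, ract.act y h hc = x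

/-- A (saturated) Fell bundle over the topological groupoid `𝒢`: an upper semicontinuous
Banach bundle `Bf` over `H` with a continuous fibred multiplication and involution
satisfying the Fell bundle axioms, whose fibres over units are C*-algebras and whose fibres
are full (imprimitivity) bimodules. -/
structure FellBundle {H : Type*} [TopologicalSpace H] (𝒢 : TopGroupoid H)
    (Bf : H → Type*) [∀ g, NormedAddCommGroup (Bf g)] [∀ g, NormedSpace ℂ (Bf g)]
    [∀ g, CompleteSpace (Bf g)] [TopologicalSpace (Σ g, Bf g)] : Type _ where
  bundle : IsUSCBanachBundle Bf
  mul : ∀ {g h : H} (hc : 𝒢.src g = 𝒢.rng h), Bf g → Bf h → Bf (𝒢.mul g h hc)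
  star' : ∀ {g : H}, Bf g → Bf (𝒢.inv g)
  mul_add : ∀ {g h} (hc : 𝒢.src g = 𝒢.rng h) (a : Bf g) (b b' : Bf h),
    mul hc a (b + b') = mul hc a b + mul hc a b'
  add_mul : ∀ {g h} (hc : 𝒢.src g = 𝒢.rng h) (a a' : Bf g) (b : Bf h),
    mul hc (a + a') b = mul hc a b + mul hc a' b
  mul_smul : ∀ {g h} (hc : 𝒢.src g = 𝒢.rng h) (c : ℂ) (a : Bf g) (b : Bf h),
    mul hc (c • a) b = c • mul hc a b
  mul_smul' : ∀ {g h} (hc : 𝒢.src g = 𝒢.rng h) (c : ℂ) (a : Bf g) (b : Bf h),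
    mul hc a (c • b) = c • mul hc a b
  norm_mul_le : ∀ {g h} (hc : 𝒢.src g = 𝒢.rng h) (a : Bf g) (b : Bf h),
    ‖mul hc a b‖ ≤ ‖a‖ * ‖b‖
  mul_assoc : ∀ {g h k} (hgh : 𝒢.src g = 𝒢.rng h) (hhk : 𝒢.src h = 𝒢.rng k)
    (h₁ : 𝒢.src (𝒢.mul g h hgh) = 𝒢.rng k) (h₂ : 𝒢.src g = 𝒢.rng (𝒢.mul h k hhk))
    (a : Bf g) (b : Bf h) (c : Bf k),
    HEq (mul h₁ (mul hgh a b) c) (mul h₂ a (mul hhk b c))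
  star_add : ∀ {g} (a b : Bf g), star' (a + b) = star' a + star' b
  star_smul : ∀ {g} (c : ℂ) (a : Bf g), star' (c • a) = (starRingEnd ℂ c) • star' a
  star_star : ∀ {g} (a : Bf g), HEq (star' (star' a)) a
  norm_star : ∀ {g} (a : Bf g), ‖star' a‖ = ‖a‖
  star_mul : ∀ {g h} (hc : 𝒢.src g = 𝒢.rng h)
    (hc' : 𝒢.src (𝒢.inv h) = 𝒢.rng (𝒢.inv g)) (a : Bf g) (b : Bf h),
    HEq (star' (mul hc a b)) (mul hc' (star' b) (star' a))
  cstar_norm : ∀ {g} (hc : 𝒢.src (𝒢.inv g) = 𝒢.rng g) (a : Bf g),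
    ‖mul hc (star' a) a‖ = ‖a‖ ^ 2
  continuous_star : Continuous (fun m : Σ g, Bf g =>
    (⟨𝒢.inv m.1, star' m.2⟩ : Σ g, Bf g))
  continuous_mul : Continuous
    (fun p : {p : (Σ g, Bf g) × (Σ g, Bf g) // 𝒢.src p.1.1 = 𝒢.rng p.2.1} =>
      (⟨𝒢.mul p.1.1.1 p.1.2.1 p.2, mul p.2 p.1.1.2 p.1.2.2⟩ : Σ g, Bf g))
  saturated : ∀ {g h} (hc : 𝒢.src g = 𝒢.rng h),
    Dense ((Submodule.span ℂ {c : Bf (𝒢.mul g h hc) | ∃ a b, c = mul hc a b} :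
      Submodule ℂ (Bf (𝒢.mul g h hc))) : Set (Bf (𝒢.mul g h hc)))

namespace FellBundle

variable {H : Type*} [TopologicalSpace H] {𝒢 : TopGroupoid H}
  {Bf : H → Type*} [∀ g, NormedAddCommGroup (Bf g)] [∀ g, NormedSpace ℂ (Bf g)]
  [∀ g, CompleteSpace (Bf g)] [TopologicalSpace (Σ g, Bf g)]

/-- Positivity in the unit-fibre C*-algebra `Bf u`: an element is nonnegative iff it is of
the form `a* a`. -/
def nonneg (FB : FellBundle 𝒢 Bf) {u : H} (_ : 𝒢.rng u = u) (b : Bf u) : Prop :=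
  ∃ a : Bf u, HEq (FB.mul (𝒢.src_inv u) (FB.star' a) a) b

/-- The order on the unit-fibre C*-algebra `Bf u`. -/
def le (FB : FellBundle 𝒢 Bf) {u : H} (hu : 𝒢.rng u = u) (a b : Bf u) : Prop :=
  FB.nonneg hu (b - a)

/-- The multiplication of the unit-fibre C*-algebra `Bf u` (the Fell bundle multiplication,
recast to land in `Bf u`). -/
def unitMul (FB : FellBundle 𝒢 Bf) {u : H} (hu : 𝒢.rng u = u)
    (hmul : 𝒢.mul u u ((congrArg 𝒢.src hu.symm).trans (𝒢.src_rng u)) = u)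
    (a b : Bf u) : Bf u :=
  cast (congrArg Bf hmul) (FB.mul ((congrArg 𝒢.src hu.symm).trans (𝒢.src_rng u)) a b)

end FellBundle

/-- A right `B`-demi-equivalence over a (principal) right `H`-space `X` (Definition 2.1):
an upper semicontinuous Banach bundle `Mf` over `X` with a right `B`-action covering the
`H`-action on `X` and a continuous `B`-valued inner product satisfying (DE1)–(DE8). -/
structure DemiEquiv {H : Type*} [TopologicalSpace H] {𝒢 : TopGroupoid H}
    {Bf : H → Type*} [∀ g, NormedAddCommGroup (Bf g)] [∀ g, NormedSpace ℂ (Bf g)]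
    [∀ g, CompleteSpace (Bf g)] [TopologicalSpace (Σ g, Bf g)]
    (FB : FellBundle 𝒢 Bf)
    {X : Type*} [TopologicalSpace X] (ra : RightGroupoidAction 𝒢 X)
    (Mf : X → Type*) [∀ x, NormedAddCommGroup (Mf x)] [∀ x, NormedSpace ℂ (Mf x)]
    [∀ x, CompleteSpace (Mf x)] [TopologicalSpace (Σ x, Mf x)] : Type _ where
  bundle : IsUSCBanachBundle Mf
  /-- (DE1) the right action, covering the `H`-action on `X` -/
  ract : ∀ (x : X) (h : H) (hc : ra.anchor x = 𝒢.rng h), Mf x → Bf h → Mf (ra.act x h hc)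
  /-- (DE2) the `B`-valued inner product, covering the map `(x, x·h) ↦ h` -/
  inner : ∀ (x : X) (h : H) (hc : ra.anchor x = 𝒢.rng h),
    Mf x → Mf (ra.act x h hc) → Bf h
  /-- (DE3) sesquilinearity -/
  inner_add_left : ∀ x h hc (m m' : Mf x) n,
    inner x h hc (m + m') n = inner x h hc m n + inner x h hc m' n
  inner_smul_left : ∀ x h hc (c : ℂ) (m : Mf x) n,
    inner x h hc (c • m) n = (starRingEnd ℂ c) • inner x h hc m n
  inner_add_right : ∀ x h hc (m : Mf x) n n',
    inner x h hc m (n + n') = inner x h hc m n + inner x h hc m n'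
  inner_smul_right : ∀ x h hc (c : ℂ) (m : Mf x) n,
    inner x h hc m (c • n) = c • inner x h hc m n
  /-- (DE3) continuity of the inner product -/
  inner_continuous : Continuous
    (fun q : {q : (Σ x, Mf x) × H × (Σ x, Mf x) //
        ∃ hc : ra.anchor q.1.1 = 𝒢.rng q.2.1, q.2.2.1 = ra.act q.1.1 q.2.1 hc} =>
      (⟨q.1.2.1, inner q.1.1.1 q.1.2.1 q.2.choose q.1.1.2
        (cast (congrArg Mf q.2.choose_spec) q.1.2.2.2)⟩ : Σ g, Bf g))
  /-- (DE4) `⟨m₁, m₂ ⊳ b⟩ = ⟨m₁, m₂⟩ b` -/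
  inner_ract : ∀ (x : X) (h k : H) (hc : ra.anchor x = 𝒢.rng h)
    (hck : 𝒢.src h = 𝒢.rng k) (hc₂ : ra.anchor (ra.act x h hc) = 𝒢.rng k)
    (hcmul : ra.anchor x = 𝒢.rng (𝒢.mul h k hck))
    (hacts : ra.act (ra.act x h hc) k hc₂ = ra.act x (𝒢.mul h k hck) hcmul)
    (m₁ : Mf x) (m₂ : Mf (ra.act x h hc)) (b : Bf k),
    inner x (𝒢.mul h k hck) hcmul m₁
        (cast (congrArg Mf hacts) (ract (ra.act x h hc) k hc₂ m₂ b))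
      = FB.mul hck (inner x h hc m₁ m₂) b
  /-- (DE5) `⟨m₁, m₂⟩* = ⟨m₂, m₁⟩` -/
  inner_star : ∀ (x : X) (h : H) (hc : ra.anchor x = 𝒢.rng h)
    (hc' : ra.anchor (ra.act x h hc) = 𝒢.rng (𝒢.inv h))
    (hback : ra.act (ra.act x h hc) (𝒢.inv h) hc' = x)
    (m : Mf x) (n : Mf (ra.act x h hc)),
    FB.star' (inner x h hc m n)
      = inner (ra.act x h hc) (𝒢.inv h) hc' n (cast (congrArg Mf hback.symm) m)
  /-- (DE6) positivity -/
  inner_self_nonneg : ∀ (x : X) (hc : ra.anchor x = 𝒢.rng (ra.anchor x)) (m : Mf x),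
    FB.nonneg (ra.anchor_unit x)
      (inner x (ra.anchor x) hc m (cast (congrArg Mf (ra.act_unit x hc).symm) m))
  /-- (DE6) definiteness -/
  inner_self_eq_zero : ∀ (x : X) (hc : ra.anchor x = 𝒢.rng (ra.anchor x)) (m : Mf x),
    inner x (ra.anchor x) hc m (cast (congrArg Mf (ra.act_unit x hc).symm) m) = 0 → m = 0
  /-- (DE7) compatibility of the norms -/
  norm_eq : ∀ (x : X) (hc : ra.anchor x = 𝒢.rng (ra.anchor x)) (m : Mf x),
    ‖m‖ = Real.sqrt
      ‖inner x (ra.anchor x) hc m (cast (congrArg Mf (ra.act_unit x hc).symm) m)‖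
  /-- (DE8) fibrewise fullness -/
  full : ∀ (x : X) (hc : ra.anchor x = 𝒢.rng (ra.anchor x)),
    Dense ((Submodule.span ℂ {b : Bf (ra.anchor x) | ∃ m n : Mf x,
      b = inner x (ra.anchor x) hc m (cast (congrArg Mf (ra.act_unit x hc).symm) n)} :
        Submodule ℂ (Bf (ra.anchor x))) : Set (Bf (ra.anchor x)))

namespace DemiEquiv

variable {H : Type*} [TopologicalSpace H] {𝒢 : TopGroupoid H}
  {Bf : H → Type*} [∀ g, NormedAddCommGroup (Bf g)] [∀ g, NormedSpace ℂ (Bf g)]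
  [∀ g, CompleteSpace (Bf g)] [TopologicalSpace (Σ g, Bf g)]
  {FB : FellBundle 𝒢 Bf}
  {X : Type*} [TopologicalSpace X] {ra : RightGroupoidAction 𝒢 X}
  {Mf : X → Type*} [∀ x, NormedAddCommGroup (Mf x)] [∀ x, NormedSpace ℂ (Mf x)]
  [∀ x, CompleteSpace (Mf x)] [TopologicalSpace (Σ x, Mf x)]

/-- The action of the unit-fibre C*-algebra `B(σ(x))` on the fibre `M(x)`. -/
def uact (DE : DemiEquiv FB ra Mf) (x : X) (m : Mf x) (b : Bf (ra.anchor x)) : Mf x :=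
  cast (congrArg Mf (ra.act_unit x (ra.anchor_unit x).symm))
    (DE.ract x (ra.anchor x) (ra.anchor_unit x).symm m b)

/-- The `B(σ(x))`-valued inner product on the fibre `M(x)`. -/
def uinner (DE : DemiEquiv FB ra Mf) (x : X) (m n : Mf x) : Bf (ra.anchor x) :=
  DE.inner x (ra.anchor x) (ra.anchor_unit x).symm m
    (cast (congrArg Mf (ra.act_unit x (ra.anchor_unit x).symm).symm) n)

end DemiEquiv

/-- A realization of the balanced tensor product `M(x) ⊗_{B(u)} M(y)^op` of two fibres of a
demi-equivalence over points with the same anchor `u = σ(x) = σ(y)`: a Banach space `T` with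
a bilinear (linear–conjugate-linear) `B(u)`-balanced map of total range, carrying the norm of
`K_{B(u)}(M(y), M(x))`. -/
structure FibreTensor {H : Type*} [TopologicalSpace H] {𝒢 : TopGroupoid H}
    {Bf : H → Type*} [∀ g, NormedAddCommGroup (Bf g)] [∀ g, NormedSpace ℂ (Bf g)]
    [∀ g, CompleteSpace (Bf g)] [TopologicalSpace (Σ g, Bf g)]
    {FB : FellBundle 𝒢 Bf}
    {X : Type*} [TopologicalSpace X] {ra : RightGroupoidAction 𝒢 X}
    {Mf : X → Type*} [∀ x, NormedAddCommGroup (Mf x)] [∀ x, NormedSpace ℂ (Mf x)]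
    [∀ x, CompleteSpace (Mf x)] [TopologicalSpace (Σ x, Mf x)]
    (DE : DemiEquiv FB ra Mf) (x y : X)
    (hxy : ra.anchor x = ra.anchor y)
    (hinv : 𝒢.inv (ra.anchor x) = ra.anchor y)
    (T : Type*) [NormedAddCommGroup T] [NormedSpace ℂ T] [CompleteSpace T] : Type _ where
  t : Mf x → Mf y → T
  add_left : ∀ m m' n, t (m + m') n = t m n + t m' n
  smul_left : ∀ (c : ℂ) m n, t (c • m) n = c • t m n
  add_right : ∀ m n n', t m (n + n') = t m n + t m n'
  conj_smul_right : ∀ (c : ℂ) m n, t m (c • n) = (starRingEnd ℂ c) • t m n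
  balanced : ∀ (m : Mf x) (n : Mf y) (b : Bf (ra.anchor x)),
    t (DE.uact x m b) n = t m (DE.uact y n (cast (congrArg Bf hinv) (FB.star' b)))
  dense_span : Dense ((Submodule.span ℂ {z : T | ∃ m n, z = t m n} : Submodule ℂ T) : Set T)
  norm_eq : ∀ (k : ℕ) (m : Fin k → Mf x) (n : Fin k → Mf y),
    ‖∑ i, t (m i) (n i)‖ = ⨆ z : {z : Mf y // ‖z‖ ≤ 1},
      ‖∑ i, DE.uact x (m i) (cast (congrArg Bf hxy.symm) (DE.uinner y (n i) z.1))‖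

/-- A packaged realization of `M(x) ⊗_{B(u)} M(y)^op`. -/
structure FibreTensorPkg {H : Type*} [TopologicalSpace H] {𝒢 : TopGroupoid H}
    {Bf : H → Type*} [∀ g, NormedAddCommGroup (Bf g)] [∀ g, NormedSpace ℂ (Bf g)]
    [∀ g, CompleteSpace (Bf g)] [TopologicalSpace (Σ g, Bf g)]
    {FB : FellBundle 𝒢 Bf}
    {X : Type*} [TopologicalSpace X] {ra : RightGroupoidAction 𝒢 X}
    {Mf : X → Type*} [∀ x, NormedAddCommGroup (Mf x)] [∀ x, NormedSpace ℂ (Mf x)]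
    [∀ x, CompleteSpace (Mf x)] [TopologicalSpace (Σ x, Mf x)]
    (DE : DemiEquiv FB ra Mf) (x y : X)
    (hxy : ra.anchor x = ra.anchor y)
    (hinv : 𝒢.inv (ra.anchor x) = ra.anchor y) : Type _ where
  T : Type
  [nacg : NormedAddCommGroup T]
  [nsp : NormedSpace ℂ T]
  [cmpl : CompleteSpace T]
  R : FibreTensor DE x y hxy hinv T

attribute [instance] FibreTensorPkg.nacg FibreTensorPkg.nsp FibreTensorPkg.cmpl

/-! ### Abstract Hilbert modules -/

/-- A Hilbert module over `A` (multiplication written so that `ip m (act n b) = b * ip m n`;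
thus `A` is the opposite of the usual coefficient algebra). -/
structure HilbMod (A E : Type*) [NonUnitalCStarAlgebra A] [NormedAddCommGroup E]
    [NormedSpace ℂ E] where
  act : E → A → E
  ip : E → E → A
  ip_add : ∀ m n n', ip m (n + n') = ip m n + ip m n'
  ip_smul : ∀ (c : ℂ) m n, ip m (c • n) = c • ip m n
  ip_star : ∀ m n, star (ip m n) = ip n m
  ip_act : ∀ m n b, ip m (act n b) = b * ip m n
  ip_pos : ∀ m, ∃ a, ip m m = a * star a
  ip_def : ∀ m, ip m m = 0 → m = 0
  norm_eq : ∀ m, ‖m‖ = Real.sqrt ‖ip m m‖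

namespace HilbMod

variable {A E F G : Type*} [NonUnitalCStarAlgebra A]
  [NormedAddCommGroup E] [NormedSpace ℂ E]
  [NormedAddCommGroup F] [NormedSpace ℂ F]
  [NormedAddCommGroup G] [NormedSpace ℂ G]

theorem norm_sq (M : HilbMod A E) (m : E) : ‖m‖ ^ 2 = ‖M.ip m m‖ := by
  rw [M.norm_eq, Real.sq_sqrt (norm_nonneg _)]

theorem ip_add_left (M : HilbMod A E) (m m' n : E) : M.ip (m + m') n = M.ip m n + M.ip m' n := by
  rw [← M.ip_star n, M.ip_add, star_add, M.ip_star, M.ip_star]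

theorem ip_smul_left (M : HilbMod A E) (c : ℂ) (m n : E) :
    M.ip (c • m) n = (starRingEnd ℂ c) • M.ip m n := by
  rw [← M.ip_star n, M.ip_smul, star_smul, M.ip_star]; rfl

theorem ip_act_left (M : HilbMod A E) (m n : E) (b : A) :
    M.ip (M.act m b) n = M.ip m n * star b := by
  rw [← M.ip_star n, M.ip_act, star_mul, M.ip_star]

theorem ip_zero (M : HilbMod A E) (m : E) : M.ip m 0 = 0 := by
  have := M.ip_smul 0 m 0
  simpa using this

theorem ip_neg (M : HilbMod A E) (m n : E) : M.ip m (-n) = - M.ip m n := by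
  have := M.ip_smul (-1) m n
  simpa using this

theorem ip_sub (M : HilbMod A E) (m n n' : E) : M.ip m (n - n') = M.ip m n - M.ip m n' := by
  rw [sub_eq_add_neg, M.ip_add, M.ip_neg, sub_eq_add_neg]

theorem ext_ip (M : HilbMod A E) {m m' : E} (h : ∀ n, M.ip n m = M.ip n m') : m = m' := by
  rw [← sub_eq_zero]
  apply M.ip_def
  rw [M.ip_sub, h, sub_self]

theorem norm_ip_le (M : HilbMod A E) (m n : E) : ‖M.ip m n‖ ≤ ‖m‖ * ‖n‖ := by
  letI : PartialOrder A := CStarAlgebra.spectralOrder A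
  haveI : StarOrderedRing A := CStarAlgebra.spectralOrderedRing A
  letI : SMul A E := ⟨fun b m => M.act m b⟩
  letI : CStarModule A E :=
    { inner := M.ip
      inner_add_right := M.ip_add _ _ _
      inner_self_nonneg := by
        intro x
        obtain ⟨a, ha⟩ := M.ip_pos x
        change 0 ≤ M.ip x x
        rw [ha]; exact mul_star_self_nonneg a
      inner_self := by
        intro x
        refine ⟨M.ip_def x, ?_⟩
        rintro rfl; exact M.ip_zero _
      inner_op_smul_right := M.ip_act _ _ _
      inner_smul_right_complex := M.ip_smul _ _ _
      star_inner := M.ip_star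
      norm_eq_sqrt_norm_inner_self := M.norm_eq }
  exact CStarModule.norm_inner_le (A := A) E (x := m) (y := n)

theorem norm_act_le (M : HilbMod A E) (m : E) (b : A) : ‖M.act m b‖ ≤ ‖m‖ * ‖b‖ := by
  refine le_of_pow_le_pow_left₀ two_ne_zero (by positivity) ?_
  rw [M.norm_sq, M.ip_act, M.ip_act_left, mul_pow, M.norm_sq m]
  calc ‖b * (M.ip m m * star b)‖ ≤ ‖b‖ * (‖M.ip m m‖ * ‖star b‖) :=
        (norm_mul_le _ _).trans (by gcongr; exact norm_mul_le _ _)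
    _ = _ := by rw [norm_star]; ring

theorem act_add (M : HilbMod A E) (m : E) (b b' : A) :
    M.act m (b + b') = M.act m b + M.act m b' :=
  M.ext_ip fun n => by simp only [M.ip_act, M.ip_add, add_mul]

theorem act_smul (M : HilbMod A E) (m : E) (c : ℂ) (b : A) :
    M.act m (c • b) = c • M.act m b :=
  M.ext_ip fun n => by simp only [M.ip_act, M.ip_smul, smul_mul_assoc]

theorem add_act (M : HilbMod A E) (m m' : E) (b : A) :
    M.act (m + m') b = M.act m b + M.act m' b :=
  M.ext_ip fun n => by simp only [M.ip_act, M.ip_add, mul_add]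

theorem smul_act (M : HilbMod A E) (m : E) (c : ℂ) (b : A) :
    M.act (c • m) b = c • M.act m b :=
  M.ext_ip fun n => by simp only [M.ip_act, M.ip_smul, mul_smul_comm]

theorem act_act (M : HilbMod A E) (m : E) (b b' : A) :
    M.act (M.act m b) b' = M.act m (b' * b) :=
  M.ext_ip fun n => by simp only [M.ip_act, mul_assoc]

/-- The rank one operator `z ↦ m ⊳ ⟨n, z⟩`. -/
noncomputable def theta (M : HilbMod A E) (N : HilbMod A F) (m : E) (n : F) : F →L[ℂ] E :=
  LinearMap.mkContinuous
    { toFun := fun z => M.act m (N.ip n z)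
      map_add' := fun z z' => by rw [N.ip_add, M.act_add]
      map_smul' := fun c z => by rw [N.ip_smul, M.act_smul]; rfl }
    (‖m‖ * ‖n‖) (fun z => by
      refine (M.norm_act_le _ _).trans ?_
      rw [mul_assoc]
      exact mul_le_mul_of_nonneg_left (N.norm_ip_le _ _) (norm_nonneg _))

theorem theta_apply (M : HilbMod A E) (N : HilbMod A F) (m : E) (n z : F) :
    M.theta N m n z = M.act m (N.ip n z) := rfl

theorem theta_comp (M : HilbMod A E) (N : HilbMod A F) (P : HilbMod A G) (m : E) (n₁ n₂ : F) (k : G) :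
    (M.theta N m n₁).comp (N.theta P n₂ k) = M.theta P (M.act m (N.ip n₁ n₂)) k := by
  ext z
  simp [theta_apply, act_act, N.ip_act]

theorem theta_smul (M : HilbMod A E) (N : HilbMod A F) (c : ℂ) (m : E) (n : F) :
    M.theta N (c • m) n = c • M.theta N m n := by
  ext z; simp [theta_apply, smul_act]

theorem iSup_norm (S : F →L[ℂ] E) : (⨆ z : {z : F // ‖z‖ ≤ 1}, ‖S z.1‖) = ‖S‖ := by
  rw [← ContinuousLinearMap.sSup_unitClosedBall_eq_norm S, sSup_image']
  apply Equiv.iSup_congr (Equiv.subtypeEquivRight (fun z => by simp))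
  intro z; rfl

/-- A concrete realisation of the balanced tensor product as operators. -/
theorem exists_rep [CompleteSpace E] (M : HilbMod A E) (N : HilbMod A F) {T : Type*}
    [NormedAddCommGroup T] [NormedSpace ℂ T]
    (t : E → F → T) (smul_left : ∀ (c : ℂ) m n, t (c • m) n = c • t m n)
    (hd : Dense ((Submodule.span ℂ {z : T | ∃ m n, z = t m n} : Submodule ℂ T) : Set T))
    (hn : ∀ (k : ℕ) (m : Fin k → E) (n : Fin k → F),
      ‖∑ i, t (m i) (n i)‖ = ⨆ z : {z : F // ‖z‖ ≤ 1}, ‖∑ i, M.act (m i) (N.ip (n i) z.1)‖) :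
    ∃ Θ : T →ₗᵢ[ℂ] (F →L[ℂ] E), ∀ m n, Θ (t m n) = M.theta N m n := by
  have hn' : ∀ (k : ℕ) (m : Fin k → E) (n : Fin k → F),
      ‖∑ i, t (m i) (n i)‖ = ‖∑ i, M.theta N (m i) (n i)‖ := by
    intro k m n
    rw [hn, ← iSup_norm]
    simp [theta_apply]
  let e : ((E × F) →₀ ℂ) →ₗ[ℂ] T := Finsupp.linearCombination ℂ (fun p => t p.1 p.2)
  let f : ((E × F) →₀ ℂ) →ₗ[ℂ] (F →L[ℂ] E) :=
    Finsupp.linearCombination ℂ (fun p => M.theta N p.1 p.2)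
  have hef : ∀ v, ‖f v‖ = ‖e v‖ := by
    intro v
    have h1 : e v = ∑ i, t (v (v.support.equivFin.symm i) • (v.support.equivFin.symm i).1.1)
        (v.support.equivFin.symm i).1.2 := by
      simp only [smul_left]
      rw [Equiv.sum_comp v.support.equivFin.symm (fun p => v p.1 • t p.1.1 p.1.2)]
      simp only [e, Finsupp.linearCombination_apply, Finsupp.sum]
      rw [← Finset.sum_coe_sort]
    have h2 : f v = ∑ i, M.theta N
        (v (v.support.equivFin.symm i) • (v.support.equivFin.symm i).1.1)
        (v.support.equivFin.symm i).1.2 := by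
      simp only [theta_smul]
      rw [Equiv.sum_comp v.support.equivFin.symm (fun p => v p.1 • M.theta N p.1.1 p.1.2)]
      simp only [f, Finsupp.linearCombination_apply, Finsupp.sum]
      rw [← Finset.sum_coe_sort]
    rw [h1, h2, hn']
  have hde : DenseRange e := by
    have : Set.range e = ((Submodule.span ℂ {z : T | ∃ m n, z = t m n} : Submodule ℂ T) : Set T) := by
      have h := Finsupp.range_linearCombination (R := ℂ) (v := fun p : E × F => t p.1 p.2)
      have h3 : Set.range (fun p : E × F => t p.1 p.2) = {z : T | ∃ m n, z = t m n} := by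
        ext z; simp [eq_comm]
      rw [h3] at h
      rw [← h]; rfl
    rw [DenseRange, this]; exact hd
  have hb : ∃ C, ∀ v, ‖f v‖ ≤ C * ‖e v‖ := ⟨1, fun v => by simp [hef]⟩
  let g := f.extendOfNorm e
  have hg : ∀ v, g (e v) = f v := LinearMap.extendOfNorm_eq hde hb
  refine ⟨{ toLinearMap := g.toLinearMap, norm_map' := ?_ }, ?_⟩
  · refine hde.induction ?_ ?_
    · rintro _ ⟨v, rfl⟩
      change ‖g (e v)‖ = _
      rw [hg, hef]
    · exact isClosed_eq g.continuous.norm continuous_norm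
  · intro m n
    change g (t m n) = _
    have := hg (Finsupp.single (m, n) 1)
    simpa [e, f] using this

/-- Existence of the multiplication, with its operator description. -/
theorem exists_mul (M : HilbMod A E) (N : HilbMod A F) (P : HilbMod A G) {T S R : Type*}
    [NormedAddCommGroup T] [NormedSpace ℂ T]
    [NormedAddCommGroup S] [NormedSpace ℂ S]
    [NormedAddCommGroup R] [NormedSpace ℂ R] [CompleteSpace R]
    (t : E → F → T) (s : F → G → S) (r : E → G → R)
    (hdt : Dense ((Submodule.span ℂ {z : T | ∃ m n, z = t m n} : Submodule ℂ T) : Set T))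
    (hds : Dense ((Submodule.span ℂ {z : S | ∃ m n, z = s m n} : Submodule ℂ S) : Set S))
    (Θt : T →ₗᵢ[ℂ] (F →L[ℂ] E)) (ht : ∀ m n, Θt (t m n) = M.theta N m n)
    (Θs : S →ₗᵢ[ℂ] (G →L[ℂ] F)) (hs : ∀ m n, Θs (s m n) = N.theta P m n)
    (Θr : R →ₗᵢ[ℂ] (G →L[ℂ] E)) (hr : ∀ m n, Θr (r m n) = M.theta P m n) :
    ∃ U : T → S → R,
      (∀ ξ ξ' η, U (ξ + ξ') η = U ξ η + U ξ' η) ∧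
      (∀ (c : ℂ) ξ η, U (c • ξ) η = c • U ξ η) ∧
      (∀ ξ η η', U ξ (η + η') = U ξ η + U ξ η') ∧
      (∀ (c : ℂ) ξ η, U ξ (c • η) = c • U ξ η) ∧
      (∀ m n₁ n₂ k, U (t m n₁) (s n₂ k) = r (M.act m (N.ip n₁ n₂)) k) ∧
      (∀ ξ η, ‖U ξ η‖ ≤ ‖ξ‖ * ‖η‖) ∧
      (∀ ξ η, Θr (U ξ η) = (Θt ξ).comp (Θs η)) := by
  have hcl : IsClosed (Set.range Θr) := Θr.isometry.isClosedEmbedding.isClosed_range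
  have hcl' : IsClosed ((LinearMap.range Θr.toLinearMap : Submodule ℂ _) : Set (G →L[ℂ] E)) := by
    exact hcl
  have key1 : ∀ m n₁ η, (Θt (t m n₁)).comp (Θs η) ∈ LinearMap.range Θr.toLinearMap := by
    intro m n₁
    refine hds.induction ?_ (hcl'.preimage (by fun_prop))
    intro η hη
    refine Submodule.span_induction ?_ ?_ ?_ ?_ hη
    · rintro _ ⟨n₂, k, rfl⟩
      rw [ht, hs, theta_comp, ← hr]
      exact ⟨_, rfl⟩
    · simp
    · intro a b _ _ ha hb
      rw [map_add, ContinuousLinearMap.comp_add]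
      exact Submodule.add_mem _ ha hb
    · intro c a _ ha
      rw [map_smul, ContinuousLinearMap.comp_smul]
      exact Submodule.smul_mem _ _ ha
  have key : ∀ η ξ, (Θt ξ).comp (Θs η) ∈ LinearMap.range Θr.toLinearMap := by
    intro η
    refine hdt.induction ?_ (hcl'.preimage (by fun_prop))
    intro ξ hξ
    refine Submodule.span_induction ?_ ?_ ?_ ?_ hξ
    · rintro _ ⟨m, n, rfl⟩
      exact key1 m n η
    · simp
    · intro a b _ _ ha hb
      rw [map_add, ContinuousLinearMap.add_comp]
      exact Submodule.add_mem _ ha hb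
    · intro c a _ ha
      rw [map_smul, ContinuousLinearMap.smul_comp]
      exact Submodule.smul_mem _ _ ha
  choose U hU using fun ξ η => key η ξ
  have hU' : ∀ ξ η, Θr (U ξ η) = (Θt ξ).comp (Θs η) := hU
  refine ⟨U, ?_, ?_, ?_, ?_, ?_, ?_, hU'⟩
  · intro ξ ξ' η; apply Θr.injective; simp [hU', ContinuousLinearMap.add_comp]
  · intro c ξ η; apply Θr.injective; simp [hU', ContinuousLinearMap.smul_comp]
  · intro ξ η η'; apply Θr.injective; simp [hU', ContinuousLinearMap.comp_add]
  · intro c ξ η; apply Θr.injective; simp [hU', ContinuousLinearMap.comp_smul]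
  · intro m n₁ n₂ k; apply Θr.injective; rw [hU', ht, hs, theta_comp, hr]
  · intro ξ η
    rw [← Θr.norm_map, hU', ← Θt.norm_map ξ, ← Θs.norm_map η]
    exact ContinuousLinearMap.opNorm_comp_le _ _

/-- The flip is the adjoint. -/
theorem flip_adjoint (M : HilbMod A E) (N : HilbMod A F) {T S : Type*}
    [NormedAddCommGroup T] [NormedSpace ℂ T]
    [NormedAddCommGroup S] [NormedSpace ℂ S]
    (t : E → F → T) (s : F → E → S)
    (hdt : Dense ((Submodule.span ℂ {z : T | ∃ m n, z = t m n} : Submodule ℂ T) : Set T))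
    (Θt : T →ₗᵢ[ℂ] (F →L[ℂ] E)) (ht : ∀ m n, Θt (t m n) = M.theta N m n)
    (Θs : S →ₗᵢ[ℂ] (E →L[ℂ] F)) (hs : ∀ m n, Θs (s m n) = N.theta M m n)
    (Flip : T → S)
    (hFlip_t : ∀ m n, Flip (t m n) = s n m)
    (hFlip_add : ∀ ξ ξ', Flip (ξ + ξ') = Flip ξ + Flip ξ')
    (hFlip_smul : ∀ (c : ℂ) ξ, Flip (c • ξ) = (starRingEnd ℂ c) • Flip ξ)
    (hFlip_norm : ∀ ξ, ‖Flip ξ‖ = ‖ξ‖) (ξ : T) (m : E) (n : F) :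
    N.ip (Θs (Flip ξ) m) n = M.ip m (Θt ξ n) := by
  have hc : Continuous Flip := by
    let φ : T →+ S := AddMonoidHom.mk' Flip hFlip_add
    exact (AddMonoidHomClass.isometry_of_norm φ hFlip_norm).continuous
  have hcM : ∀ m, Continuous (M.ip m) := fun m => by
    let L : E →ₗ[ℂ] A := { toFun := M.ip m, map_add' := M.ip_add m, map_smul' := fun c n => M.ip_smul c m n }
    exact (L.mkContinuous ‖m‖ (fun n => M.norm_ip_le m n)).continuous
  have hcN : ∀ n, Continuous (fun m => N.ip m n) := fun n => by
    have h2 : Continuous (N.ip n) := by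
      let L : F →ₗ[ℂ] A := { toFun := N.ip n, map_add' := N.ip_add n, map_smul' := fun c m => N.ip_smul c n m }
      exact (L.mkContinuous ‖n‖ (fun m => N.norm_ip_le n m)).continuous
    have h3 : (fun m => N.ip m n) = fun m => star (N.ip n m) := by
      ext m; rw [N.ip_star]
    rw [h3]; exact h2.star
  revert ξ
  refine hdt.induction ?_ ?_
  · intro ξ hξ
    refine Submodule.span_induction ?_ ?_ ?_ ?_ hξ
    · rintro _ ⟨m', n', rfl⟩
      rw [hFlip_t, hs, ht, theta_apply, theta_apply, N.ip_act_left, M.ip_act, M.ip_star]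
    · have : Flip 0 = 0 := by rw [← norm_eq_zero, hFlip_norm, norm_zero]
      rw [this]
      simp only [map_zero, ContinuousLinearMap.zero_apply, M.ip_zero]
      rw [← N.ip_star, N.ip_zero, star_zero]
    · intro a b _ _ ha hb
      simp only [hFlip_add, map_add, ContinuousLinearMap.add_apply, N.ip_add_left, M.ip_add, ha, hb]
    · intro c a _ ha
      simp only [hFlip_smul, map_smul, ContinuousLinearMap.smul_apply, N.ip_smul_left, M.ip_smul, ha]
      simp
  · refine isClosed_eq ((hcN n).comp ?_) ((hcM m).comp ?_)
    · exact (ContinuousLinearMap.apply ℂ F m).continuous.comp (Θs.continuous.comp hc)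
    · exact (ContinuousLinearMap.apply ℂ E n).continuous.comp Θt.continuous

theorem sq_norm_le_of_adjoint (M : HilbMod A E) (N : HilbMod A F) (S : F →L[ℂ] E) (S' : E →L[ℂ] F)
    (h : ∀ m n, N.ip (S' m) n = M.ip m (S n)) : ‖S'‖ ^ 2 ≤ ‖S.comp S'‖ := by
  have : ‖S'‖ ≤ Real.sqrt ‖S.comp S'‖ := by
    refine S'.opNorm_le_bound (Real.sqrt_nonneg _) fun m => ?_
    refine le_of_pow_le_pow_left₀ two_ne_zero (by positivity) ?_
    rw [mul_pow, Real.sq_sqrt (norm_nonneg _), N.norm_sq, h]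
    calc _ ≤ ‖m‖ * ‖(S.comp S') m‖ := M.norm_ip_le _ _
      _ ≤ ‖m‖ * (‖S.comp S'‖ * ‖m‖) := by gcongr; exact ContinuousLinearMap.le_opNorm _ _
      _ = _ := by ring
  calc _ ≤ (Real.sqrt ‖S.comp S'‖) ^ 2 := by gcongr
    _ = _ := Real.sq_sqrt (norm_nonneg _)

end HilbMod

/-! ### The unit fibres of a Fell bundle, and the fibres of a demi-equivalence -/

theorem norm_cast_fibre {I : Type*} {E : I → Type*} [∀ i, NormedAddCommGroup (E i)]
    {i j : I} (h : i = j) (h' : E i = E j) (a : E i) : ‖cast h' a‖ = ‖a‖ := by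
  subst h; rfl

theorem cast_add_fibre {I : Type*} {E : I → Type*} [∀ i, NormedAddCommGroup (E i)]
    {i j : I} (h : i = j) (h' : E i = E j) (a b : E i) :
    cast h' (a + b) = cast h' a + cast h' b := by
  subst h; rfl

theorem cast_smul_fibre {I : Type*} {E : I → Type*} [∀ i, NormedAddCommGroup (E i)]
    [∀ i, NormedSpace ℂ (E i)]
    {i j : I} (h : i = j) (h' : E i = E j) (c : ℂ) (a : E i) :
    cast h' (c • a) = c • cast h' a := by
  subst h; rfl

namespace FellBundle

variable {H : Type*} [TopologicalSpace H] {𝒢 : TopGroupoid H}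
  {Bf : H → Type*} [∀ g, NormedAddCommGroup (Bf g)] [∀ g, NormedSpace ℂ (Bf g)]
  [∀ g, CompleteSpace (Bf g)] [TopologicalSpace (Σ g, Bf g)]

theorem mul_heq (FB : FellBundle 𝒢 Bf) {g g' h h' : H} (hg : g = g') (hh : h = h')
    (hc : 𝒢.src g = 𝒢.rng h) (hc' : 𝒢.src g' = 𝒢.rng h') {a : Bf g} {a' : Bf g'}
    {b : Bf h} {b' : Bf h'} (ha : HEq a a') (hb : HEq b b') :
    HEq (FB.mul hc a b) (FB.mul hc' a' b') := by
  subst hg hh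
  cases ha; cases hb; rfl

theorem star_heq (FB : FellBundle 𝒢 Bf) {g g' : H} (hg : g = g') {a : Bf g} {a' : Bf g'}
    (ha : HEq a a') : HEq (FB.star' a) (FB.star' a') := by
  subst hg
  cases ha; rfl

theorem unit_src {u : H} (hu : 𝒢.rng u = u) : 𝒢.src u = u := by
  have := 𝒢.src_rng u
  rwa [hu] at this

theorem unit_comp {u : H} (hu : 𝒢.rng u = u) : 𝒢.src u = 𝒢.rng u :=
  (unit_src hu).trans hu.symm

theorem unit_mul {u : H} (hu : 𝒢.rng u = u) (hc : 𝒢.src u = 𝒢.rng u) : 𝒢.mul u u hc = u := by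
  have h := 𝒢.mul_src u (𝒢.rng_src u).symm
  have e := unit_src hu
  convert h using 2
  exact e.symm

/-- Multiplication of the unit fibre. -/
def um (FB : FellBundle 𝒢 Bf) {u : H} (hu : 𝒢.rng u = u) (a b : Bf u) : Bf u :=
  cast (congrArg Bf (unit_mul hu (unit_comp hu))) (FB.mul (unit_comp hu) a b)

/-- Involution of the unit fibre. -/
def us (FB : FellBundle 𝒢 Bf) {u : H} (hi : 𝒢.inv u = u) (a : Bf u) : Bf u :=
  cast (congrArg Bf hi) (FB.star' a)

theorem um_heq (FB : FellBundle 𝒢 Bf) {u : H} (hu : 𝒢.rng u = u) (a b : Bf u) :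
    HEq (FB.um hu a b) (FB.mul (unit_comp hu) a b) := cast_heq _ _

theorem us_heq (FB : FellBundle 𝒢 Bf) {u : H} (hi : 𝒢.inv u = u) (a : Bf u) :
    HEq (FB.us hi a) (FB.star' a) := cast_heq _ _

theorem um_assoc (FB : FellBundle 𝒢 Bf) {u : H} (hu : 𝒢.rng u = u) (a b c : Bf u) :
    FB.um hu (FB.um hu a b) c = FB.um hu a (FB.um hu b c) := by
  have hm := unit_mul hu (unit_comp hu)
  have h1 : 𝒢.src (𝒢.mul u u (unit_comp hu)) = 𝒢.rng u := by rw [hm]; exact unit_comp hu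
  have h2 : 𝒢.src u = 𝒢.rng (𝒢.mul u u (unit_comp hu)) := by rw [hm]; exact unit_comp hu
  apply eq_of_heq
  refine (FB.um_heq hu _ _).trans (HEq.trans ?_ (FB.um_heq hu _ _).symm)
  refine (FB.mul_heq hm.symm rfl _ h1 (FB.um_heq hu a b) HEq.rfl).trans ?_
  refine (FB.mul_assoc (unit_comp hu) (unit_comp hu) h1 h2 a b c).trans ?_
  exact FB.mul_heq rfl hm h2 _ HEq.rfl (FB.um_heq hu b c).symm

theorem us_us (FB : FellBundle 𝒢 Bf) {u : H} (hi : 𝒢.inv u = u) (a : Bf u) :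
    FB.us hi (FB.us hi a) = a := by
  apply eq_of_heq
  refine (FB.us_heq hi _).trans ?_
  refine (FB.star_heq hi.symm (FB.us_heq hi a)).trans (FB.star_star a)

theorem us_um (FB : FellBundle 𝒢 Bf) {u : H} (hu : 𝒢.rng u = u) (hi : 𝒢.inv u = u)
    (a b : Bf u) : FB.us hi (FB.um hu a b) = FB.um hu (FB.us hi b) (FB.us hi a) := by
  have hm := unit_mul hu (unit_comp hu)
  have hc' : 𝒢.src (𝒢.inv u) = 𝒢.rng (𝒢.inv u) := by rw [hi]; exact unit_comp hu
  apply eq_of_heq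
  refine (FB.us_heq hi _).trans ?_
  refine (FB.star_heq hm.symm (FB.um_heq hu a b)).trans ?_
  refine (FB.star_mul (unit_comp hu) hc' a b).trans ?_
  refine (FB.mul_heq hi hi hc' (unit_comp hu) (FB.us_heq hi b).symm (FB.us_heq hi a).symm).trans ?_
  exact (FB.um_heq hu _ _).symm

theorem um_us_self_heq (FB : FellBundle 𝒢 Bf) {u : H} (hu : 𝒢.rng u = u) (hi : 𝒢.inv u = u)
    (a : Bf u) : HEq (FB.um hu (FB.us hi a) a) (FB.mul (𝒢.src_inv u) (FB.star' a) a) :=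
  (FB.um_heq hu _ _).trans
    (FB.mul_heq hi.symm rfl _ _ (FB.us_heq hi a) HEq.rfl)

theorem norm_um_us (FB : FellBundle 𝒢 Bf) {u : H} (hu : 𝒢.rng u = u) (hi : 𝒢.inv u = u)
    (a : Bf u) : ‖FB.um hu (FB.us hi a) a‖ = ‖a‖ ^ 2 := by
  rw [← FB.cstar_norm (𝒢.src_inv u) a]
  have he := FB.um_us_self_heq hu hi a
  have hg : u = 𝒢.mul (𝒢.inv u) u (𝒢.src_inv u) := by
    rw [𝒢.inv_mul, unit_src hu]
  rw [← cast_eq_iff_heq (e := congrArg Bf hg)] at he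
  rw [← he, norm_cast_fibre hg]

theorem norm_us (FB : FellBundle 𝒢 Bf) {u : H} (hi : 𝒢.inv u = u)
    (a : Bf u) : ‖FB.us hi a‖ = ‖a‖ := by
  rw [us, norm_cast_fibre hi, FB.norm_star]

theorem norm_um_le (FB : FellBundle 𝒢 Bf) {u : H} (hu : 𝒢.rng u = u) (a b : Bf u) :
    ‖FB.um hu a b‖ ≤ ‖a‖ * ‖b‖ := by
  rw [um, norm_cast_fibre (unit_mul hu _)]
  exact FB.norm_mul_le _ _ _

/-- The (opposite) C*-algebra structure of the unit fibre. -/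
@[reducible]
def opCStar (FB : FellBundle 𝒢 Bf) {u : H} (hu : 𝒢.rng u = u) (hi : 𝒢.inv u = u) :
    NonUnitalCStarAlgebra (Bf u) :=
  have hm := unit_mul hu (unit_comp hu)
  have ha : ∀ a b c : Bf u, FB.um hu (a + b) c = FB.um hu a c + FB.um hu b c := fun a b c => by
    simp only [um, FB.add_mul, cast_add_fibre hm]
  have ha' : ∀ a b c : Bf u, FB.um hu a (b + c) = FB.um hu a b + FB.um hu a c := fun a b c => by
    simp only [um, FB.mul_add, cast_add_fibre hm]
  have hs : ∀ (c : ℂ) (a b : Bf u), FB.um hu (c • a) b = c • FB.um hu a b := fun c a b => by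
    simp only [um, FB.mul_smul, cast_smul_fibre hm]
  have hs' : ∀ (c : ℂ) (a b : Bf u), FB.um hu a (c • b) = c • FB.um hu a b := fun c a b => by
    simp only [um, FB.mul_smul', cast_smul_fibre hm]
  { (inferInstance : NormedAddCommGroup (Bf u)), (inferInstance : NormedSpace ℂ (Bf u)),
    (inferInstance : CompleteSpace (Bf u)) with
    mul := fun a b => FB.um hu b a
    left_distrib := fun a b c => ha b c a
    right_distrib := fun a b c => ha' c a b
    zero_mul := fun a => by
      have := hs' 0 a 0
      simp only [zero_smul] at this
      exact this
    mul_zero := fun a => by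
      have := hs 0 0 a
      simp only [zero_smul] at this
      exact this
    mul_assoc := fun a b c => (FB.um_assoc hu c b a).symm
    norm_mul_le := fun a b => (FB.norm_um_le hu b a).trans (le_of_eq (mul_comm _ _))
    star := FB.us hi
    star_involutive := FB.us_us hi
    star_mul := fun a b => FB.us_um hu hi b a
    star_add := fun a b => by
      change FB.us hi (a + b) = FB.us hi a + FB.us hi b
      simp only [us, FB.star_add, cast_add_fibre hi]
    norm_mul_self_le := fun a => by
      change ‖a‖ * ‖a‖ ≤ ‖FB.um hu a (FB.us hi a)‖
      have := FB.norm_um_us hu hi (FB.us hi a)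
      rw [FB.us_us, FB.norm_us] at this
      rw [this, sq]
    smul_assoc := fun c a b => hs' c b a
    smul_comm := fun c a b => (hs c b a).symm
    star_smul := fun c a => by
      change FB.us hi (c • a) = (starRingEnd ℂ c) • FB.us hi a
      simp only [us, FB.star_smul, cast_smul_fibre hi] }

end FellBundle

namespace DemiEquiv

variable {H : Type*} [TopologicalSpace H] {𝒢 : TopGroupoid H}
  {Bf : H → Type*} [∀ g, NormedAddCommGroup (Bf g)] [∀ g, NormedSpace ℂ (Bf g)]
  [∀ g, CompleteSpace (Bf g)] [TopologicalSpace (Σ g, Bf g)]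
  {FB : FellBundle 𝒢 Bf}
  {X : Type*} [TopologicalSpace X] {ra : RightGroupoidAction 𝒢 X}
  {Mf : X → Type*} [∀ x, NormedAddCommGroup (Mf x)] [∀ x, NormedSpace ℂ (Mf x)]
  [∀ x, CompleteSpace (Mf x)] [TopologicalSpace (Σ x, Mf x)]

theorem inner_heq (DE : DemiEquiv FB ra Mf) {x x' : X} {h h' : H} (hx : x = x') (hh : h = h')
    (hc : ra.anchor x = 𝒢.rng h) (hc' : ra.anchor x' = 𝒢.rng h')
    {m : Mf x} {m' : Mf x'} {n : Mf (ra.act x h hc)} {n' : Mf (ra.act x' h' hc')}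
    (hm : HEq m m') (hn : HEq n n') :
    HEq (DE.inner x h hc m n) (DE.inner x' h' hc' m' n') := by
  subst hx hh
  cases hm; cases hn; rfl

theorem ract_heq (DE : DemiEquiv FB ra Mf) {x x' : X} {h h' : H} (hx : x = x') (hh : h = h')
    (hc : ra.anchor x = 𝒢.rng h) (hc' : ra.anchor x' = 𝒢.rng h')
    {m : Mf x} {m' : Mf x'} {b : Bf h} {b' : Bf h'}
    (hm : HEq m m') (hb : HEq b b') :
    HEq (DE.ract x h hc m b) (DE.ract x' h' hc' m' b') := by
  subst hx hh
  cases hm; cases hb; rfl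

theorem uinner_uact (DE : DemiEquiv FB ra Mf) (x : X) (m n : Mf x) (b : Bf (ra.anchor x)) :
    DE.uinner x m (DE.uact x n b) = FB.um (ra.anchor_unit x) (DE.uinner x m n) b := by
  have hu := ra.anchor_unit x
  have hm := FellBundle.unit_mul hu (FellBundle.unit_comp hu)
  have hx := ra.act_unit x hu.symm
  have hc₂ : ra.anchor (ra.act x (ra.anchor x) hu.symm) = 𝒢.rng (ra.anchor x) := by
    rw [hx, hu]
  have hcmul : ra.anchor x = 𝒢.rng (𝒢.mul (ra.anchor x) (ra.anchor x)
      (FellBundle.unit_comp hu)) := by rw [hm, hu]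
  have hacts := ra.act_mul x (ra.anchor x) (ra.anchor x) hu.symm hc₂
    (FellBundle.unit_comp hu) hcmul
  have key := DE.inner_ract x (ra.anchor x) (ra.anchor x) hu.symm (FellBundle.unit_comp hu)
    hc₂ hcmul hacts m (cast (congrArg Mf hx.symm) n) b
  apply eq_of_heq
  refine HEq.trans ?_ (FB.um_heq hu _ _).symm
  refine HEq.trans ?_ (heq_of_eq key)
  refine DE.inner_heq rfl hm.symm _ _ HEq.rfl ?_
  refine (cast_heq _ _).trans (HEq.trans ?_ (cast_heq _ _).symm)
  refine (cast_heq _ _).trans ?_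
  exact DE.ract_heq hx.symm rfl _ _ (cast_heq _ _).symm HEq.rfl

theorem uinner_star (DE : DemiEquiv FB ra Mf) (x : X) (hi : 𝒢.inv (ra.anchor x) = ra.anchor x)
    (m n : Mf x) : FB.us hi (DE.uinner x m n) = DE.uinner x n m := by
  have hu := ra.anchor_unit x
  have hx := ra.act_unit x hu.symm
  have hc' : ra.anchor (ra.act x (ra.anchor x) hu.symm) = 𝒢.rng (𝒢.inv (ra.anchor x)) := by
    rw [hx, hi, hu]
  have hback : ra.act (ra.act x (ra.anchor x) hu.symm) (𝒢.inv (ra.anchor x)) hc' = x := by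
    refine Eq.trans ?_ hx
    congr 1
  have key := DE.inner_star x (ra.anchor x) hu.symm hc' hback m (cast (congrArg Mf hx.symm) n)
  apply eq_of_heq
  refine (FB.us_heq hi _).trans ?_
  refine (heq_of_eq key).trans ?_
  refine DE.inner_heq hx hi _ _ (cast_heq _ _) ?_
  exact (cast_heq _ _).trans (cast_heq _ _).symm

/-- The Hilbert module structure on a fibre. -/
def hilb (DE : DemiEquiv FB ra Mf) (x : X) {u : H} (h : ra.anchor x = u)
    (hu : 𝒢.rng u = u) (hi : 𝒢.inv u = u) :
    @HilbMod (Bf u) (Mf x) (FB.opCStar hu hi) _ _ :=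
  letI := FB.opCStar hu hi
  { act := fun m b => DE.uact x m (cast (congrArg Bf h.symm) b)
    ip := fun m n => cast (congrArg Bf h) (DE.uinner x m n)
    ip_add := by
      subst h
      intro m n n'
      change DE.uinner x m (n + n') = DE.uinner x m n + DE.uinner x m n'
      unfold uinner
      rw [cast_add_fibre (ra.act_unit x (ra.anchor_unit x).symm).symm, DE.inner_add_right]
    ip_smul := by
      subst h
      intro c m n
      change DE.uinner x m (c • n) = c • DE.uinner x m n
      unfold uinner
      rw [cast_smul_fibre (ra.act_unit x (ra.anchor_unit x).symm).symm, DE.inner_smul_right]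
    ip_star := by
      subst h
      exact DE.uinner_star x hi
    ip_act := by
      subst h
      exact DE.uinner_uact x
    ip_pos := by
      subst h
      intro m
      obtain ⟨a, ha⟩ := DE.inner_self_nonneg x (ra.anchor_unit x).symm m
      refine ⟨a, ?_⟩
      change DE.uinner x m m = FB.um hu (FB.us hi a) a
      exact (eq_of_heq ((FB.um_us_self_heq hu hi a).trans ha)).symm
    ip_def := by
      subst h
      exact DE.inner_self_eq_zero x (ra.anchor_unit x).symm
    norm_eq := by
      subst h
      exact DE.norm_eq x (ra.anchor_unit x).symm }

end DemiEquiv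

/-- **Lemma 3.6** (`lem:U maps`), (U1)–(U2). -/
theorem demiEquiv_fibre_multiplication_exists
    {H : Type*} [TopologicalSpace H] [LocallyCompactSpace H] [T2Space H]
    {X : Type*} [TopologicalSpace X] [LocallyCompactSpace X] [T2Space X]
    {𝒢 : TopGroupoid H} (hsrc : 𝒢.OpenSource)
    {Bf : H → Type*} [∀ g, NormedAddCommGroup (Bf g)] [∀ g, NormedSpace ℂ (Bf g)]
    [∀ g, CompleteSpace (Bf g)] [TopologicalSpace (Σ g, Bf g)]
    {FB : FellBundle 𝒢 Bf}
    {ra : RightGroupoidAction 𝒢 X} (hprin : ra.IsPrincipal)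
    (hopen : ra.OpenAnchor) (hsurj : ra.SurjAnchor)
    {Mf : X → Type*} [∀ x, NormedAddCommGroup (Mf x)] [∀ x, NormedSpace ℂ (Mf x)]
    [∀ x, CompleteSpace (Mf x)] [TopologicalSpace (Σ x, Mf x)]
    (DE : DemiEquiv FB ra Mf) (x y z : X)
    (hxy : ra.anchor x = ra.anchor y) (hinvxy : 𝒢.inv (ra.anchor x) = ra.anchor y)
    (hyz : ra.anchor y = ra.anchor z) (hinvyz : 𝒢.inv (ra.anchor y) = ra.anchor z)
    (hinvyx : 𝒢.inv (ra.anchor y) = ra.anchor x)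
    (hinvxx : 𝒢.inv (ra.anchor x) = ra.anchor x)
    (hinvxz : 𝒢.inv (ra.anchor x) = ra.anchor z)
    (Kxy : FibreTensorPkg DE x y hxy hinvxy)
    (Kyz : FibreTensorPkg DE y z hyz hinvyz)
    (Kxz : FibreTensorPkg DE x z (hxy.trans hyz) hinvxz)
    (Kyx : FibreTensorPkg DE y x hxy.symm hinvyx)
    (Kxx : FibreTensorPkg DE x x rfl hinvxx)
    -- Flip is the conjugate-linear isometric map M(x) ⊗ M(y)^op → M(y) ⊗ M(x)^op
    -- corresponding to the adjoint T ↦ T* of compact operators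
    (Flip : Kxy.T → Kyx.T)
    (hFlip_t : ∀ m n, Flip (Kxy.R.t m n) = Kyx.R.t n m)
    (hFlip_add : ∀ ξ ξ', Flip (ξ + ξ') = Flip ξ + Flip ξ')
    (hFlip_smul : ∀ (c : ℂ) ξ, Flip (c • ξ) = (starRingEnd ℂ c) • Flip ξ)
    (hFlip_norm : ∀ ξ, ‖Flip ξ‖ = ‖ξ‖) :
    -- (U) the multiplication map exists …
    (∃ U : Kxy.T → Kyz.T → Kxz.T,
      -- (U1) bilinearity
      (∀ ξ ξ' η, U (ξ + ξ') η = U ξ η + U ξ' η) ∧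
      (∀ (c : ℂ) ξ η, U (c • ξ) η = c • U ξ η) ∧
      (∀ ξ η η', U ξ (η + η') = U ξ η + U ξ η') ∧
      (∀ (c : ℂ) ξ η, U ξ (c • η) = c • U ξ η) ∧
      -- determined on elementary tensors by U(m ⊗ n₁^op, n₂ ⊗ k^op) = (m ⊳ ⟨n₁,n₂⟩) ⊗ k^op
      (∀ (m : Mf x) (n₁ n₂ : Mf y) (k : Mf z),
        U (Kxy.R.t m n₁) (Kyz.R.t n₂ k)
          = Kxz.R.t (DE.uact x m (cast (congrArg Bf hxy.symm) (DE.uinner y n₁ n₂))) k) ∧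
      -- (U2) ‖U(ξ, η)‖ ≤ ‖ξ‖·‖η‖
      (∀ ξ η, ‖U ξ η‖ ≤ ‖ξ‖ * ‖η‖)) ∧
    -- (U2') and ‖U(ξ, Flip ξ)‖ = ‖ξ‖², for the companion map into M(x) ⊗ M(x)^op
    (∃ U' : Kxy.T → Kyx.T → Kxx.T,
      (∀ ξ ξ' η, U' (ξ + ξ') η = U' ξ η + U' ξ' η) ∧
      (∀ (c : ℂ) ξ η, U' (c • ξ) η = c • U' ξ η) ∧
      (∀ ξ η η', U' ξ (η + η') = U' ξ η + U' ξ η') ∧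
      (∀ (c : ℂ) ξ η, U' ξ (c • η) = c • U' ξ η) ∧
      (∀ (m : Mf x) (n₁ n₂ : Mf y) (k : Mf x),
        U' (Kxy.R.t m n₁) (Kyx.R.t n₂ k)
          = Kxx.R.t (DE.uact x m (cast (congrArg Bf hxy.symm) (DE.uinner y n₁ n₂))) k) ∧
      (∀ ξ η, ‖U' ξ η‖ ≤ ‖ξ‖ * ‖η‖) ∧
      (∀ ξ, ‖U' ξ (Flip ξ)‖ = ‖ξ‖ ^ 2)) := by
  have hu := ra.anchor_unit y
  have hi : 𝒢.inv (ra.anchor y) = ra.anchor y := hinvyx.trans hxy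
  letI := FB.opCStar hu hi
  let M := DE.hilb x hxy hu hi
  let N := DE.hilb y rfl hu hi
  let P := DE.hilb z hyz.symm hu hi
  obtain ⟨Θxy, hΘxy⟩ := M.exists_rep N Kxy.R.t Kxy.R.smul_left Kxy.R.dense_span Kxy.R.norm_eq
  obtain ⟨Θyz, hΘyz⟩ := N.exists_rep P Kyz.R.t Kyz.R.smul_left Kyz.R.dense_span Kyz.R.norm_eq
  obtain ⟨Θyx, hΘyx⟩ := N.exists_rep M Kyx.R.t Kyx.R.smul_left Kyx.R.dense_span Kyx.R.norm_eq
  obtain ⟨Θxz, hΘxz⟩ := M.exists_rep P Kxz.R.t Kxz.R.smul_left Kxz.R.dense_span (by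
    intro k m n
    rw [Kxz.R.norm_eq]
    simp only [M, P, DemiEquiv.hilb, cast_cast])
  obtain ⟨Θxx, hΘxx⟩ := M.exists_rep M Kxx.R.t Kxx.R.smul_left Kxx.R.dense_span (by
    intro k m n
    rw [Kxx.R.norm_eq]
    simp only [M, DemiEquiv.hilb, cast_cast])
  constructor
  · obtain ⟨U, h1, h2, h3, h4, h5, h6, -⟩ := M.exists_mul N P Kxy.R.t Kyz.R.t Kxz.R.t
      Kxy.R.dense_span Kyz.R.dense_span Θxy hΘxy Θyz hΘyz Θxz hΘxz
    exact ⟨U, h1, h2, h3, h4, h5, h6⟩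
  · obtain ⟨U, h1, h2, h3, h4, h5, h6, h7⟩ := M.exists_mul N M Kxy.R.t Kyx.R.t Kxx.R.t
      Kxy.R.dense_span Kyx.R.dense_span Θxy hΘxy Θyx hΘyx Θxx hΘxx
    refine ⟨U, h1, h2, h3, h4, h5, h6, fun ξ => le_antisymm ?_ ?_⟩
    · refine (h6 _ _).trans (le_of_eq ?_)
      rw [hFlip_norm, sq]
    · have had := M.flip_adjoint N Kxy.R.t Kyx.R.t Kxy.R.dense_span Θxy hΘxy Θyx hΘyx Flip
        hFlip_t hFlip_add hFlip_smul hFlip_norm ξ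
      have := M.sq_norm_le_of_adjoint N (Θxy ξ) (Θyx (Flip ξ)) had
      rw [Θyx.norm_map, hFlip_norm, ← h7, Θxx.norm_map] at this
      exact this
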